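/- For all α > 0 and β > −1/2, the following inequality for the Euler beta function holds: B(2α/(2α+2β+1), (2β+1)/(2α+2β+1)) ≥ (1/(2α)) · ((2α+2β+1)(2α+β+1)/(2(β+1)(α+β+1)))². -/

import Mathlib

/-- The Euler beta function B(x,y) = ∫₀¹ t^{x−1}(1−t)^{y−1} dt. -/
noncomputable def eulerBeta (x y : ℝ) : ℝ :=
  ∫ t in (0:ℝ)..1, t ^ (x - 1) * (1 - t) ^ (y - 1)

lemma eulerBeta_eq_aux (x y : ℝ) (hx : 0 < x) (hy : 0 < y) (hxy : x + y = 1) :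
    eulerBeta x y = Real.pi / Real.sin (Real.pi * y) := by
  have h1 : ((eulerBeta x y : ℝ) : ℂ) = Complex.betaIntegral x y := by
    unfold eulerBeta Complex.betaIntegral
    rw [← intervalIntegral.integral_ofReal]
    apply intervalIntegral.integral_congr
    intro t ht
    rw [Set.uIcc_of_le zero_le_one] at ht
    have h2 : (0:ℝ) ≤ 1 - t := by linarith [ht.2]
    simp only
    rw [Complex.ofReal_mul, Complex.ofReal_cpow ht.1, Complex.ofReal_cpow h2]
    push_cast
    rfl
  have h2 := ProbabilityTheory.beta_eq_betaIntegralReal x y hx hy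
  rw [← h1, Complex.ofReal_re] at h2
  rw [← h2, ProbabilityTheory.beta, hxy, Real.Gamma_one, div_one, mul_comm,
    ← Real.Gamma_mul_Gamma_one_sub]
  rw [show x = 1 - y by linarith]

lemma sin_pi_mul_le_aux (y : ℝ) (hy : 0 < y) (hy1 : y < 1) :
    Real.sin (Real.pi * y) ≤ Real.pi * y * (1 - y ^ 2) := by
  refine le_of_tendsto (Real.tendsto_euler_sin_prod y) ?_
  filter_upwards [Filter.eventually_ge_atTop 1] with n hn
  have hpi := Real.pi_pos
  refine mul_le_mul_of_nonneg_left ?_ (by positivity)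
  obtain ⟨m, rfl⟩ : ∃ m, n = m + 1 := ⟨n - 1, by omega⟩
  rw [Finset.prod_range_succ']
  have hy2 : y ^ 2 ≤ 1 := by nlinarith
  have hle : ∏ k ∈ Finset.range m, (1 - y ^ 2 / (((k + 1 : ℕ) : ℝ) + 1) ^ 2) ≤ 1 := by
    apply Finset.prod_le_one
    · intro i _
      have : y ^ 2 / (((i + 1 : ℕ) : ℝ) + 1) ^ 2 ≤ 1 := by
        rw [div_le_one (by positivity)]
        have : (0:ℝ) ≤ ((i + 1 : ℕ) : ℝ) := by positivity
        nlinarith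
      linarith
    · intro i _
      have : 0 ≤ y ^ 2 / (((i + 1 : ℕ) : ℝ) + 1) ^ 2 := by positivity
      linarith
  have h0 : (1 - y ^ 2 / (((0 : ℕ) : ℝ) + 1) ^ 2) = 1 - y ^ 2 := by norm_num
  rw [h0]
  nlinarith

lemma poly_aux (a b : ℝ) (ha : 0 < a) (hb : 0 < b) :
    b * (a + 2 * b) * (2 * a + b + 1) ^ 2 ≤ (a + b) * (b + 1) ^ 2 * (a + b + 1) ^ 2 := by
  have h1 : 4 * b ≤ (b + 1) ^ 2 := by nlinarith [sq_nonneg (b - 1)]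
  have h2 : (a + 2 * b) * (2 * a + b + 1) ^ 2 ≤ 4 * (a + b) * (a + b + 1) ^ 2 := by
    have : 0 ≤ 4 * (a + b) * (a + b + 1) ^ 2 - (a + 2 * b) * (2 * a + b + 1) ^ 2 := by
      ring_nf
      positivity
    linarith
  calc _ = b * ((a + 2 * b) * (2 * a + b + 1) ^ 2) := by ring
    _ ≤ b * (4 * (a + b) * (a + b + 1) ^ 2) := by gcongr
    _ = (4 * b) * ((a + b) * (a + b + 1) ^ 2) := by ring
    _ ≤ (b + 1) ^ 2 * ((a + b) * (a + b + 1) ^ 2) := by gcongr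
    _ = _ := by ring

lemma main_aux (a b : ℝ) (ha : 0 < a) (hb : 0 < b) :
    (1 / a) * ((a + b) * (2 * a + b + 1) / ((b + 1) * (a + b + 1))) ^ 2 ≤
      eulerBeta (a / (a + b)) (b / (a + b)) := by
  have hS : 0 < a + b := by positivity
  have hpi := Real.pi_pos
  have hy : 0 < b / (a + b) := by positivity
  have hy1 : b / (a + b) < 1 := by rw [div_lt_one hS]; linarith
  rw [eulerBeta_eq_aux _ _ (by positivity) hy (by field_simp)]
  have hsin : 0 < Real.sin (Real.pi * (b / (a + b))) :=
    Real.sin_pos_of_pos_of_lt_pi (by positivity) (by nlinarith)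
  have hle := sin_pi_mul_le_aux _ hy hy1
  have h3 : (a + b) ^ 3 / (a * b * (a + 2 * b)) ≤
      Real.pi / Real.sin (Real.pi * (b / (a + b))) := by
    rw [div_le_div_iff₀ (by positivity) hsin]
    calc _ ≤ (a + b) ^ 3 * (Real.pi * (b / (a + b)) * (1 - (b / (a + b)) ^ 2)) := by gcongr
      _ = _ := by field_simp; ring
  refine le_trans ?_ h3
  rw [div_pow, div_mul_div_comm, div_le_div_iff₀ (by positivity) (by positivity)]
  have := mul_le_mul_of_nonneg_left (poly_aux a b ha hb) (show 0 ≤ a * (a + b) ^ 2 by positivity)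
  linarith

/-- For all α > 0 and β > −1/2:
B(2α/(2α+2β+1), (2β+1)/(2α+2β+1)) ≥ (1/(2α))((2α+2β+1)(2α+β+1)/(2(β+1)(α+β+1)))². -/
theorem stmt12 (α β : ℝ) (hα : 0 < α) (hβ : -(1/2 : ℝ) < β) :
    (1/(2*α)) * ((2*α+2*β+1)*(2*α+β+1) / (2*(β+1)*(α+β+1)))^2 ≤
      eulerBeta (2*α/(2*α+2*β+1)) ((2*β+1)/(2*α+2*β+1)) := by
  have h := main_aux (2 * α) (2 * β + 1) (by linarith) (by linarith)
  have e : (2*α+2*β+1)*(2*α+β+1) / (2*(β+1)*(α+β+1)) =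
      (2 * α + (2 * β + 1)) * (2 * (2 * α) + (2 * β + 1) + 1) /
        ((2 * β + 1 + 1) * (2 * α + (2 * β + 1) + 1)) := by
    have h1 : β + 1 ≠ 0 := by linarith
    have h2 : α + β + 1 ≠ 0 := by linarith
    rw [show 2 * β + 1 + 1 = 2 * (β + 1) by ring,
      show 2 * α + (2 * β + 1) + 1 = 2 * (α + β + 1) by ring]
    field_simp
    ring
  rw [e, add_assoc (2 * α) (2 * β) 1]
  exact h
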